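/- Linear convergence of the greedy (value-based) inner update: assume min_s ρ_s > 0, fix a policy π ∈ Π, let p* ∈ argmax_{p∈𝒫} J_ρ(π,p), and let (p_t) satisfy the greedy update in which, for each t and each state s, p_{t+1,s} is a maximizer of x ↦ ⟨ĝ^{π,p_t}_s, x⟩ over x ∈ 𝒫_s. Then for every t ≥ 0: J_ρ(π,p*) − J_ρ(π,p_t) ≤ (1 − (1−γ)/M)^t · ( J_ρ(π,p*) − J_ρ(π,p_0) ). -/

import Mathlib

open scoped BigOperators

noncomputable section

namespace RMDPStmt

variable {S A : ℕ}

/-- `p` is a transition kernel: each `p s a` lies in the probability simplex `Δ^S`. -/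
def IsKernel (p : Fin S → Fin A → Fin S → ℝ) : Prop :=
  ∀ s a, p s a ∈ stdSimplex ℝ (Fin S)

/-- `π` is a stationary randomized policy: each `π s` lies in the simplex `Δ^A`. -/
def IsPolicy (π : Fin S → Fin A → ℝ) : Prop :=
  ∀ s, π s ∈ stdSimplex ℝ (Fin A)

/-- The state-to-state matrix `P^π`. -/
def Pmat (π : Fin S → Fin A → ℝ) (p : Fin S → Fin A → Fin S → ℝ) :
    Matrix (Fin S) (Fin S) ℝ :=
  Matrix.of fun s s' => ∑ a, π s a * p s a s'

/-- The expected one-step cost vector `c^π`. -/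
def cvec (c : Fin S → Fin A → Fin S → ℝ) (π : Fin S → Fin A → ℝ)
    (p : Fin S → Fin A → Fin S → ℝ) : Fin S → ℝ :=
  fun s => ∑ a, π s a * ∑ s', p s a s' * c s a s'

/-- Value function `v^{π,p}` as a discounted series. -/
def value (γ : ℝ) (c : Fin S → Fin A → Fin S → ℝ) (π : Fin S → Fin A → ℝ)
    (p : Fin S → Fin A → Fin S → ℝ) : Fin S → ℝ :=
  fun s => ∑' t : ℕ, γ ^ t * ((Pmat π p ^ t).mulVec (cvec c π p)) s

/-- The return `J_ρ(π,p)`. -/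
def J (γ : ℝ) (c : Fin S → Fin A → Fin S → ℝ) (ρ : Fin S → ℝ)
    (π : Fin S → Fin A → ℝ) (p : Fin S → Fin A → Fin S → ℝ) : ℝ :=
  ∑ s, ρ s * value γ c π p s

/-- The action-value function `q^{π,p}`. -/
def qval (γ : ℝ) (c : Fin S → Fin A → Fin S → ℝ) (π : Fin S → Fin A → ℝ)
    (p : Fin S → Fin A → Fin S → ℝ) : Fin S → Fin A → ℝ :=
  fun s a => ∑ s', p s a s' * (c s a s' + γ * value γ c π p s')

/-- The discounted state occupancy measure `d^{π,p}_ρ`. -/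
def occ (γ : ℝ) (ρ : Fin S → ℝ) (π : Fin S → Fin A → ℝ)
    (p : Fin S → Fin A → Fin S → ℝ) : Fin S → ℝ :=
  fun s' => (1 - γ) * ∑' t : ℕ, γ ^ t * ∑ s, ρ s * (Pmat π p ^ t) s s'

/-- Bregman divergence generated by `h`. -/
def breg {E : Type*} [NormedAddCommGroup E] [NormedSpace ℝ E]
    (h : E → ℝ) (x y : E) : ℝ :=
  h x - h y - fderiv ℝ h y (x - y)

/-- Weighted Bregman divergence `B_μ`. -/
def bregW {E : Type*} [NormedAddCommGroup E] [NormedSpace ℝ E]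
    (μ : Fin S → ℝ) (h : E → ℝ) (x y : Fin S → E) : ℝ :=
  ∑ s, μ s * breg h (x s) (y s)

/-- Inner product of two action-indexed vectors. -/
def dotA (u v : Fin A → ℝ) : ℝ := ∑ a, u a * v a

/-- Inner product of two action-by-state arrays. -/
def dotAS (u v : Fin A → Fin S → ℝ) : ℝ := ∑ a, ∑ s', u a s' * v a s'

/-- The robust objective `Φ(π) = sup_{p ∈ Amb} J_ρ(π,p)`. -/
def Phi (γ : ℝ) (c : Fin S → Fin A → Fin S → ℝ) (ρ : Fin S → ℝ)
    (Amb : Set (Fin S → Fin A → Fin S → ℝ)) (π : Fin S → Fin A → ℝ) : ℝ :=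
  sSup ((fun p => J γ c ρ π p) '' Amb)

/-- The distribution mismatch coefficient
`M = sup_{π ∈ Π, p ∈ Amb} max_s d^{π,p}_ρ(s)/ρ_s`. -/
def mismatch (γ : ℝ) (ρ : Fin S → ℝ)
    (Amb : Set (Fin S → Fin A → Fin S → ℝ)) : ℝ :=
  sSup {x : ℝ | ∃ (π : Fin S → Fin A → ℝ) (p : Fin S → Fin A → Fin S → ℝ),
    IsPolicy π ∧ p ∈ Amb ∧ ∃ s, x = occ γ ρ π p s / ρ s}


/-- The array `ĝ^{π,p}_s ∈ ℝ^{A×S}` with `(ĝ^{π,p}_s)_{as'} = π_{sa}(c_{sas'} + γ v^{π,p}_{s'})`. -/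
def ghat {S A : ℕ} (γ : ℝ) (c : Fin S → Fin A → Fin S → ℝ)
    (π : Fin S → Fin A → ℝ) (p : Fin S → Fin A → Fin S → ℝ) (s : Fin S) :
    Fin A → Fin S → ℝ :=
  fun a s' => π s a * (c s a s' + γ * value γ c π p s')

theorem summable_pow_mul_apply {n : Type*} [Fintype n] [DecidableEq n] {P : Matrix n n ℝ}
    (hP : P ∈ Matrix.rowStochastic ℝ n) {γ : ℝ} (hγ0 : 0 ≤ γ) (hγ1 : γ < 1) (i j : n) :
    Summable fun t : ℕ => γ ^ t * (P ^ t) i j := by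
  refine Summable.of_nonneg_of_le (fun t => ?_) (fun t => ?_)
    (summable_geometric_of_lt_one hγ0 hγ1)
  · exact mul_nonneg (pow_nonneg hγ0 t) (Matrix.nonneg_of_mem_rowStochastic (pow_mem hP t))
  · exact mul_le_of_le_one_right (pow_nonneg hγ0 t)
      (Matrix.le_one_of_mem_rowStochastic (pow_mem hP t))

theorem Pmat_mem_rowStochastic {π : Fin S → Fin A → ℝ} {p : Fin S → Fin A → Fin S → ℝ}
    (hπ : IsPolicy π) (hp : IsKernel p) : Pmat π p ∈ Matrix.rowStochastic ℝ (Fin S) := by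
  rw [Matrix.mem_rowStochastic_iff_sum]
  simp only [Pmat, Matrix.of_apply]
  refine ⟨fun s s' => Finset.sum_nonneg fun a _ => mul_nonneg ((hπ s).1 a) ((hp s a).1 s'),
    fun s => ?_⟩
  rw [Finset.sum_comm]
  simp_rw [← Finset.mul_sum, (hp s _).2, mul_one]
  exact (hπ s).2

/-- Bellman equation for the value function. -/
theorem value_eq {γ : ℝ} (hγ0 : 0 ≤ γ) (hγ1 : γ < 1) (c : Fin S → Fin A → Fin S → ℝ)
    {π : Fin S → Fin A → ℝ} {p : Fin S → Fin A → Fin S → ℝ}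
    (hP : Pmat π p ∈ Matrix.rowStochastic ℝ (Fin S)) (s : Fin S) :
    value γ c π p s = cvec c π p s + γ * ∑ s', Pmat π p s s' * value γ c π p s' := by
  have hsum (i : Fin S) :
      Summable fun t : ℕ => γ ^ t * ((Pmat π p ^ t).mulVec (cvec c π p)) i := by
    simp only [Matrix.mulVec, dotProduct, Finset.mul_sum, ← mul_assoc]
    exact summable_sum fun j _ => (summable_pow_mul_apply hP hγ0 hγ1 i j).mul_right _
  simp only [value]
  rw [(hsum s).tsum_eq_zero_add]
  simp_rw [← tsum_mul_left]
  rw [← Summable.tsum_finsetSum fun j _ => (hsum j).mul_left _, ← tsum_mul_left]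
  congr 1
  · simp
  · refine tsum_congr fun t => ?_
    rw [pow_succ' (Pmat π p), ← Matrix.mulVec_mulVec]
    conv_lhs => rw [Matrix.mulVec, dotProduct]
    rw [Finset.mul_sum, Finset.mul_sum]
    exact Finset.sum_congr rfl fun j _ => by ring

theorem occ_nonneg {γ : ℝ} (hγ0 : 0 ≤ γ) (hγ1 : γ < 1) {ρ : Fin S → ℝ} (hρ : ∀ s, 0 ≤ ρ s)
    {π : Fin S → Fin A → ℝ} {p : Fin S → Fin A → Fin S → ℝ}
    (hP : Pmat π p ∈ Matrix.rowStochastic ℝ (Fin S)) (s : Fin S) : 0 ≤ occ γ ρ π p s :=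
  mul_nonneg (by linarith) <| tsum_nonneg fun t => mul_nonneg (pow_nonneg hγ0 t) <|
    Finset.sum_nonneg fun i _ =>
      mul_nonneg (hρ i) (Matrix.nonneg_of_mem_rowStochastic (pow_mem hP t))

/-- Flow-balance equation for the occupancy measure. -/
theorem occ_eq {γ : ℝ} (hγ0 : 0 ≤ γ) (hγ1 : γ < 1) (ρ : Fin S → ℝ)
    {π : Fin S → Fin A → ℝ} {p : Fin S → Fin A → Fin S → ℝ}
    (hP : Pmat π p ∈ Matrix.rowStochastic ℝ (Fin S)) (s : Fin S) :
    occ γ ρ π p s = (1 - γ) * ρ s + γ * ∑ i, occ γ ρ π p i * Pmat π p i s := by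
  have hsum (j : Fin S) : Summable fun t : ℕ => γ ^ t * ∑ i, ρ i * (Pmat π p ^ t) i j := by
    simp only [Finset.mul_sum, mul_left_comm (γ ^ _)]
    exact summable_sum fun i _ => (summable_pow_mul_apply hP hγ0 hγ1 i j).mul_left _
  simp only [occ, mul_assoc (1 - γ)]
  rw [← Finset.mul_sum, (hsum s).tsum_eq_zero_add, mul_left_comm γ, ← mul_add]
  simp_rw [← tsum_mul_right]
  rw [← Summable.tsum_finsetSum fun j _ => (hsum j).mul_right _, ← tsum_mul_left]
  congr 2
  · simp [Matrix.one_apply]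
  · refine tsum_congr fun t => ?_
    simp_rw [pow_succ (Pmat π p), Matrix.mul_apply, Finset.mul_sum, Finset.sum_mul, Finset.mul_sum]
    rw [Finset.sum_comm]
    exact Finset.sum_congr rfl fun j _ => Finset.sum_congr rfl fun i _ => by ring

theorem sum_occ_mul_sub {γ : ℝ} (hγ0 : 0 ≤ γ) (hγ1 : γ < 1) (ρ : Fin S → ℝ)
    {π : Fin S → Fin A → ℝ} {p : Fin S → Fin A → Fin S → ℝ}
    (hP : Pmat π p ∈ Matrix.rowStochastic ℝ (Fin S)) (f : Fin S → ℝ) :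
    ∑ s, occ γ ρ π p s * (f s - γ * ∑ s', Pmat π p s s' * f s') = (1 - γ) * ∑ s, ρ s * f s := by
  have h : ∑ s, occ γ ρ π p s * f s = (1 - γ) * ∑ s, ρ s * f s +
      ∑ s, occ γ ρ π p s * (γ * ∑ s', Pmat π p s s' * f s') := by
    conv_lhs => enter [2, s]; rw [occ_eq hγ0 hγ1 ρ hP s]
    simp_rw [add_mul, Finset.sum_add_distrib, Finset.mul_sum, Finset.sum_mul]
    congr 1
    · exact Finset.sum_congr rfl fun j _ => by ring
    · rw [Finset.sum_comm]
      exact Finset.sum_congr rfl fun j _ => Finset.sum_congr rfl fun i _ => by ring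
  simp_rw [mul_sub, Finset.sum_sub_distrib]
  linarith

theorem sum_occ {γ : ℝ} (hγ0 : 0 ≤ γ) (hγ1 : γ < 1) {ρ : Fin S → ℝ} (hρ : ∑ s, ρ s = 1)
    {π : Fin S → Fin A → ℝ} {p : Fin S → Fin A → Fin S → ℝ}
    (hP : Pmat π p ∈ Matrix.rowStochastic ℝ (Fin S)) : ∑ s, occ γ ρ π p s = 1 := by
  have h := sum_occ_mul_sub hγ0 hγ1 ρ hP fun _ => 1
  simp only [mul_one, Matrix.sum_row_of_mem_rowStochastic hP, hρ, ← Finset.sum_mul] at h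
  exact mul_right_cancel₀ (sub_pos.2 hγ1).ne' (by linarith)

theorem one_sub_mul_le_occ {γ : ℝ} (hγ0 : 0 ≤ γ) (hγ1 : γ < 1) {ρ : Fin S → ℝ}
    (hρ : ∀ s, 0 ≤ ρ s) {π : Fin S → Fin A → ℝ} {p : Fin S → Fin A → Fin S → ℝ}
    (hP : Pmat π p ∈ Matrix.rowStochastic ℝ (Fin S)) (s : Fin S) :
    (1 - γ) * ρ s ≤ occ γ ρ π p s := by
  rw [occ_eq hγ0 hγ1 ρ hP s, le_add_iff_nonneg_right]
  exact mul_nonneg hγ0 <| Finset.sum_nonneg fun i _ =>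
    mul_nonneg (occ_nonneg hγ0 hγ1 hρ hP i) (Matrix.nonneg_of_mem_rowStochastic hP)

theorem occ_div_le_mismatch {γ : ℝ} (hγ0 : 0 ≤ γ) (hγ1 : γ < 1) {ρ : Fin S → ℝ}
    (hρ : ρ ∈ stdSimplex ℝ (Fin S)) {Amb : Set (Fin S → Fin A → Fin S → ℝ)}
    (hAmb : ∀ p ∈ Amb, IsKernel p) {π : Fin S → Fin A → ℝ} (hπ : IsPolicy π)
    {p : Fin S → Fin A → Fin S → ℝ} (hp : p ∈ Amb) (s : Fin S) :
    occ γ ρ π p s / ρ s ≤ mismatch γ ρ Amb := by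
  refine le_csSup ⟨∑ i, 1 / ρ i, ?_⟩ ⟨π, p, hπ, hp, s, rfl⟩
  rintro _ ⟨π', q, hπ', hq, i, rfl⟩
  have hQ := Pmat_mem_rowStochastic hπ' (hAmb q hq)
  have hocc : occ γ ρ π' q i ≤ 1 := (sum_occ hγ0 hγ1 hρ.2 hQ).symm ▸
    Finset.single_le_sum (fun j _ => occ_nonneg hγ0 hγ1 hρ.1 hQ j) (Finset.mem_univ i)
  exact (div_le_div_of_nonneg_right hocc (hρ.1 i)).trans <|
    Finset.single_le_sum (f := fun j => 1 / ρ j)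
      (fun j _ => one_div_nonneg.2 (hρ.1 j)) (Finset.mem_univ i)

theorem dotAS_ghat (γ : ℝ) (c : Fin S → Fin A → Fin S → ℝ) (π : Fin S → Fin A → ℝ)
    (p q : Fin S → Fin A → Fin S → ℝ) (s : Fin S) :
    dotAS (ghat γ c π p s) (q s) =
      cvec c π q s + γ * ∑ s', Pmat π q s s' * value γ c π p s' := by
  simp only [dotAS, ghat, cvec, Pmat, Matrix.of_apply, Finset.mul_sum, Finset.sum_mul]
  rw [Finset.sum_comm (s := (Finset.univ : Finset (Fin S))), ← Finset.sum_add_distrib]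
  refine Finset.sum_congr rfl fun a _ => ?_
  rw [← Finset.sum_add_distrib]
  exact Finset.sum_congr rfl fun i _ => by ring

/-- Performance difference identity across transition kernels. -/
theorem sum_occ_mul_dotAS_sub_value {γ : ℝ} (hγ0 : 0 ≤ γ) (hγ1 : γ < 1)
    (c : Fin S → Fin A → Fin S → ℝ) (ρ : Fin S → ℝ) {π : Fin S → Fin A → ℝ}
    (p : Fin S → Fin A → Fin S → ℝ) {q : Fin S → Fin A → Fin S → ℝ}
    (hQ : Pmat π q ∈ Matrix.rowStochastic ℝ (Fin S)) :
    ∑ s, occ γ ρ π q s * (dotAS (ghat γ c π p s) (q s) - value γ c π p s) =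
      (1 - γ) * (J γ c ρ π q - J γ c ρ π p) := by
  have h := sum_occ_mul_sub hγ0 hγ1 ρ hQ fun s => value γ c π q s - value γ c π p s
  simp only [mul_sub, Finset.sum_sub_distrib] at h
  simp only [J, mul_sub, Finset.sum_sub_distrib, ← h]
  rw [← Finset.sum_sub_distrib, ← Finset.sum_sub_distrib, ← Finset.sum_sub_distrib,
    ← Finset.sum_sub_distrib]
  refine Finset.sum_congr rfl fun s _ => ?_
  rw [dotAS_ghat, value_eq hγ0 hγ1 c hQ s]
  ring

/-- Linear convergence of the greedy (value-based) inner update. -/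
theorem greedy_inner_linear_convergence
    {S A : ℕ} (hS : 0 < S) (hA : 0 < A)
    (γ : ℝ) (hγ : γ ∈ Set.Ioo (0 : ℝ) 1)
    (c : Fin S → Fin A → Fin S → ℝ)
    (hc : ∀ s a s', c s a s' ∈ Set.Icc (0 : ℝ) 1)
    (ρ : Fin S → ℝ) (hρ : ρ ∈ stdSimplex ℝ (Fin S)) (hρpos : ∀ s, 0 < ρ s)
    -- s-rectangular ambiguity set
    (Ps : Fin S → Set (Fin A → Fin S → ℝ))
    (hPsne : ∀ s, (Ps s).Nonempty) (hPscpt : ∀ s, IsCompact (Ps s))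
    (hPsconv : ∀ s, Convex ℝ (Ps s))
    (hPssub : ∀ s, ∀ x ∈ Ps s, ∀ a, x a ∈ stdSimplex ℝ (Fin S))
    (Amb : Set (Fin S → Fin A → Fin S → ℝ))
    (hAmb : Amb = {p | ∀ s, p s ∈ Ps s})
    -- fixed policy
    (π : Fin S → Fin A → ℝ) (hπ : IsPolicy π)
    -- worst-case transition kernel p⋆ ∈ argmax_{p ∈ Amb} J_ρ(π,p)
    (ps : Fin S → Fin A → Fin S → ℝ) (hps : ps ∈ Amb)
    (hpsmax : ∀ q ∈ Amb, J γ c ρ π q ≤ J γ c ρ π ps)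
    -- greedy iterates: p_{t+1,s} maximizes ⟨ĝ^{π,p_t}_s, ·⟩ over Ps s
    (p : ℕ → Fin S → Fin A → Fin S → ℝ) (hp : ∀ t s, p t s ∈ Ps s)
    (hupd : ∀ t s, ∀ x ∈ Ps s,
      dotAS (ghat γ c π (p t) s) x ≤
        dotAS (ghat γ c π (p t) s) (p (t + 1) s)) :
    ∀ t : ℕ,
      J γ c ρ π ps - J γ c ρ π (p t) ≤
        (1 - (1 - γ) / mismatch γ ρ Amb) ^ t *
          (J γ c ρ π ps - J γ c ρ π (p 0)) := by
  obtain ⟨hγ0, hγ1⟩ := hγ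
  have hγ0 := hγ0.le
  have hKer : ∀ q ∈ Amb, IsKernel q := by
    subst hAmb
    exact fun q hq s a => hPssub s (q s) (hq s) a
  have hpA (t : ℕ) : p t ∈ Amb := by rw [hAmb]; exact hp t
  have hpsP (s : Fin S) : ps s ∈ Ps s := by rw [hAmb] at hps; exact hps s
  have hstoch {q : Fin S → Fin A → Fin S → ℝ} (hq : q ∈ Amb) :=
    Pmat_mem_rowStochastic hπ (hKer q hq)
  have hM : 1 - γ ≤ mismatch γ ρ Amb := by
    refine le_trans ?_ (occ_div_le_mismatch hγ0 hγ1 hρ hKer hπ hps ⟨0, hS⟩)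
    rw [le_div_iff₀ (hρpos _)]
    exact one_sub_mul_le_occ hγ0 hγ1 hρ.1 (hstoch hps) _
  have hγpos : 0 < 1 - γ := sub_pos.2 hγ1
  have hMpos : 0 < mismatch γ ρ Amb := hγpos.trans_le hM
  have hstep (t : ℕ) : J γ c ρ π ps - J γ c ρ π (p (t + 1)) ≤
      (1 - (1 - γ) / mismatch γ ρ Amb) * (J γ c ρ π ps - J γ c ρ π (p t)) := by
    set G : Fin S → ℝ :=
      fun s => dotAS (ghat γ c π (p t) s) (p (t + 1) s) - value γ c π (p t) s
    have hG0 (s : Fin S) : 0 ≤ G s := by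
      have h := hupd t s (p t s) (hp t s)
      rw [dotAS_ghat, ← value_eq hγ0 hγ1 c (hstoch (hpA t))] at h
      exact sub_nonneg.2 h
    have hub : (1 - γ) * (J γ c ρ π ps - J γ c ρ π (p t)) ≤
        mismatch γ ρ Amb * ∑ s, ρ s * G s := by
      rw [← sum_occ_mul_dotAS_sub_value hγ0 hγ1 c ρ (p t) (hstoch hps), Finset.mul_sum]
      refine Finset.sum_le_sum fun s _ => ?_
      rw [← mul_assoc]
      exact mul_le_mul_of_nonneg ((div_le_iff₀ (hρpos s)).1
          (occ_div_le_mismatch hγ0 hγ1 hρ hKer hπ hps s))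
        (sub_le_sub_right (hupd t s (ps s) (hpsP s)) _)
        (occ_nonneg hγ0 hγ1 hρ.1 (hstoch hps) s) (hG0 s)
    have hlb : ∑ s, ρ s * G s ≤ J γ c ρ π (p (t + 1)) - J γ c ρ π (p t) := by
      refine le_of_mul_le_mul_left ?_ hγpos
      rw [← sum_occ_mul_dotAS_sub_value hγ0 hγ1 c ρ (p t) (hstoch (hpA (t + 1))),
        Finset.mul_sum]
      refine Finset.sum_le_sum fun s _ => ?_
      rw [← mul_assoc]
      exact mul_le_mul_of_nonneg_right
        (one_sub_mul_le_occ hγ0 hγ1 hρ.1 (hstoch (hpA (t + 1))) s) (hG0 s)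
    have hgap : (1 - γ) / mismatch γ ρ Amb * (J γ c ρ π ps - J γ c ρ π (p t)) ≤
        J γ c ρ π (p (t + 1)) - J γ c ρ π (p t) := by
      rw [div_mul_eq_mul_div, div_le_iff₀ hMpos, mul_comm _ (mismatch γ ρ Amb)]
      exact hub.trans (mul_le_mul_of_nonneg_left hlb hMpos.le)
    linarith
  have hrate : 0 ≤ 1 - (1 - γ) / mismatch γ ρ Amb := sub_nonneg.2 ((div_le_one hMpos).2 hM)
  intro t
  induction t with
  | zero => simp
  | succ t ih =>
    rw [pow_succ', mul_assoc]
    exact (hstep t).trans (mul_le_mul_of_nonneg_left ih hrate)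

end RMDPStmt
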